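/- arXiv:math/0105219 — 4 statements merged into one kernel-verified Lean document; each statement's English description precedes it below -/
import Mathlib

section
/- Let F be a field and let α be an arithmetic function with values in F such that α(1) = 0 and α(p) ≠ 0 for some prime number p. Then α is irreducible in the ring of arithmetic functions under Dirichlet convolution; that is, α is a nonzero nonunit that cannot be written as a product of two nonunits. -/
/-- At a prime, the Dirichlet product of two arithmetic functions vanishing at `1` vanishes. -/
theorem ArithmeticFunction.mul_apply_prime_eq_zero {R : Type*} [Semiring R]
    {f g : ArithmeticFunction R} (hf : f 1 = 0) (hg : g 1 = 0) {p : ℕ} (hp : p.Prime) :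
    (f * g) p = 0 := by
  rw [ArithmeticFunction.mul_apply]
  refine Finset.sum_eq_zero fun x hx => ?_
  obtain ⟨hx, -⟩ := Nat.mem_divisorsAntidiagonal.mp hx
  rcases (Nat.dvd_prime hp).mp (Dvd.intro _ hx) with h | h
  · rw [h, hf, zero_mul]
  · have h2 : x.2 = 1 := by
      rw [h] at hx
      exact Nat.eq_of_mul_eq_mul_left hp.pos (by rw [hx, mul_one])
    rw [h2, hg, mul_zero]

/-- An arithmetic function over a field with `α 1 = 0` that is nonzero at some prime
is irreducible: it is a nonzero nonunit that cannot be written as a product of two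
nonunits. -/
theorem stmt_6 (F : Type*) [Field F] (α : ArithmeticFunction F)
    (hα1 : α 1 = 0) (p : ℕ) (hp : p.Prime) (hαp : α p ≠ 0) :
    α ≠ 0 ∧ Irreducible α := by
  refine ⟨fun h => hαp (by rw [h, ArithmeticFunction.zero_apply]), ?_, fun f g hfg => ?_⟩
  · rw [ArithmeticFunction.isUnit_iff_isUnit_apply_one, hα1]
    exact not_isUnit_zero
  · rw [ArithmeticFunction.isUnit_iff_isUnit_apply_one,
      ArithmeticFunction.isUnit_iff_isUnit_apply_one, isUnit_iff_ne_zero, isUnit_iff_ne_zero]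
    by_contra! h
    exact hαp (hfg ▸ ArithmeticFunction.mul_apply_prime_eq_zero h.1 h.2 hp)
end

section
/- Let F be a field and let α, β, γ be arithmetic functions with values in F such that α = β∗γ (Dirichlet convolution), where α and β are nonzero and have the same rank q. Then γ(1) ≠ 0, i.e., γ is a unit, so α and β are associates. -/
namespace ArithmeticFunction

/-- If `f` vanishes below `n`, the Dirichlet product `f * g` takes at `n` the value `f n * g 1`. -/
theorem mul_apply_eq_mul_one_of_forall_lt {R : Type*} [Semiring R] {f g : ArithmeticFunction R}
    {n : ℕ} (hn : n ≠ 0) (hf : ∀ m < n, f m = 0) : (f * g) n = f n * g 1 := by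
  rw [mul_apply, Finset.sum_eq_single_of_mem (n, 1) (by simp [hn])]
  rintro ⟨d, e⟩ hde hne
  obtain ⟨rfl, -⟩ := Nat.mem_divisorsAntidiagonal.mp hde
  have hlt : d < d * e := by
    refine (Nat.le_of_dvd (Nat.pos_of_ne_zero hn) (dvd_mul_right d e)).lt_of_ne fun hd => hne ?_
    have he : e = 1 := by
      simpa [left_ne_zero_of_mul hn] using hd.symm
    simp [he]
  simp [hf d hlt]

end ArithmeticFunction

/-- If `α = β * γ` where nonzero `α` and `β` have the same rank `q`, then
`γ 1 ≠ 0`, i.e. `γ` is a unit, so `α` and `β` are associates. -/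
theorem stmt_7 (F : Type*) [Field F] (α β γ : ArithmeticFunction F) (q : ℕ)
    (hα0 : α ≠ 0) (hβ0 : β ≠ 0) (h : α = β * γ)
    (hqα : IsLeast {n | 0 < n ∧ α n ≠ 0} q)
    (hqβ : IsLeast {n | 0 < n ∧ β n ≠ 0} q) :
    γ 1 ≠ 0 ∧ IsUnit γ ∧ Associated α β := by
  have hβ : ∀ m < q, β m = 0 := fun m hm => by
    by_contra hne
    have hm0 : m ≠ 0 := fun h0 => hne (by simp [h0])
    exact hm.not_ge (hqβ.2 ⟨Nat.pos_of_ne_zero hm0, hne⟩)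
  have hγ1 : γ 1 ≠ 0 := by
    have hαq := hqα.1.2
    rw [h, ArithmeticFunction.mul_apply_eq_mul_one_of_forall_lt hqα.1.1.ne' hβ] at hαq
    exact right_ne_zero_of_mul hαq
  have hγ : IsUnit γ :=
    ArithmeticFunction.isUnit_iff_isUnit_apply_one.mpr hγ1.isUnit
  exact ⟨hγ1, hγ, h ▸ associated_mul_unit_left β γ hγ⟩
end

section
/- Let F be a field and let α, β be nonzero arithmetic functions with values in F. If α divides β in the ring of arithmetic functions under Dirichlet convolution, then the rank of α divides the rank of β (as positive integers). -/
/-- The rank of a nonzero arithmetic function: the least (positive) integer at which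
it is nonzero. -/
noncomputable def rank {F : Type*} [Field F] (α : ArithmeticFunction F) : ℕ :=
  sInf {n | α n ≠ 0}

namespace ArithmeticFunction

variable {F : Type*} [Field F] {α β : ArithmeticFunction F}

theorem apply_rank_ne_zero (hα : α ≠ 0) : α (rank α) ≠ 0 := by
  have hne : {n | α n ≠ 0}.Nonempty := by
    by_contra h
    refine hα (ext fun n => ?_)
    by_contra hn
    exact h ⟨n, hn⟩
  exact Nat.sInf_mem hne

theorem rank_le_of_apply_ne_zero {n : ℕ} (h : α n ≠ 0) : rank α ≤ n :=
  Nat.sInf_le h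

theorem rank_pos (hα : α ≠ 0) : 0 < rank α := by
  refine Nat.pos_of_ne_zero fun h => apply_rank_ne_zero hα ?_
  rw [h, ArithmeticFunction.map_zero]

theorem rank_mul_rank_le_of_mul_apply_ne_zero {n : ℕ} (h : (α * β) n ≠ 0) :
    rank α * rank β ≤ n := by
  rw [mul_apply] at h
  obtain ⟨x, hx, hne⟩ := Finset.exists_ne_zero_of_sum_ne_zero h
  rw [← (Nat.mem_divisorsAntidiagonal.mp hx).1]
  exact Nat.mul_le_mul (rank_le_of_apply_ne_zero (left_ne_zero_of_mul hne))
    (rank_le_of_apply_ne_zero (right_ne_zero_of_mul hne))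

theorem mul_apply_rank_mul_rank (hα : α ≠ 0) (hβ : β ≠ 0) :
    (α * β) (rank α * rank β) = α (rank α) * β (rank β) := by
  have ha := rank_pos hα
  have hb := rank_pos hβ
  rw [mul_apply]
  refine Finset.sum_eq_single (rank α, rank β) (fun x hx hne => ?_) (fun hx => ?_)
  · by_contra h
    have h₁ := rank_le_of_apply_ne_zero (left_ne_zero_of_mul h)
    have h₂ := rank_le_of_apply_ne_zero (right_ne_zero_of_mul h)
    have hprod := (Nat.mem_divisorsAntidiagonal.mp hx).1
    exact hne (Prod.ext (by nlinarith) (by nlinarith))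
  · exact absurd (Nat.mem_divisorsAntidiagonal.mpr ⟨rfl, (Nat.mul_pos ha hb).ne'⟩) hx

theorem rank_mul (hα : α ≠ 0) (hβ : β ≠ 0) : rank (α * β) = rank α * rank β := by
  have hne : (α * β) (rank α * rank β) ≠ 0 := by
    rw [mul_apply_rank_mul_rank hα hβ]
    exact mul_ne_zero (apply_rank_ne_zero hα) (apply_rank_ne_zero hβ)
  refine (rank_le_of_apply_ne_zero hne).antisymm
    (rank_mul_rank_le_of_mul_apply_ne_zero (apply_rank_ne_zero fun h => hne ?_))
  rw [h, zero_apply]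

end ArithmeticFunction


/-- If `α` divides `β` in the ring of arithmetic functions under Dirichlet
convolution (both nonzero), then the rank of `α` divides the rank of `β`. -/
theorem stmt_8 (F : Type*) [Field F] (α β : ArithmeticFunction F)
    (hα : α ≠ 0) (hβ : β ≠ 0) (h : α ∣ β) :
    rank α ∣ rank β := by
  obtain ⟨γ, rfl⟩ := h
  exact ⟨rank γ, ArithmeticFunction.rank_mul hα (right_ne_zero_of_mul hβ)⟩
end

section
/- Let F be a field. The ring of arithmetic functions with values in F under pointwise addition and Dirichlet convolution is a unique factorization domain: every nonzero element can be written as a unit times a finite product of irreducible elements, and this representation is unique up to the order of the factors and replacement of factors by associates. -/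
open Polynomial in
theorem Polynomial.Monic.isDistinguishedAt_of_dvd {A : Type*} [CommRing A] [IsLocalRing A]
    {p w : A[X]} (hp : p.Monic) (hw : w.IsDistinguishedAt (IsLocalRing.maximalIdeal A))
    (h : p ∣ w) : p.IsDistinguishedAt (IsLocalRing.maximalIdeal A) := by
  have h1 : p.map (IsLocalRing.residue A) ∣ X ^ w.natDegree := by
    have := Polynomial.map_dvd (IsLocalRing.residue A) h
    rwa [show w.map (IsLocalRing.residue A) = X ^ w.natDegree from hw.map_eq_X_pow] at this
  obtain ⟨k, -, hk⟩ := (dvd_prime_pow Polynomial.prime_X _).1 h1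
  have hk' : p.map (IsLocalRing.residue A) = X ^ k :=
    eq_of_monic_of_associated (hp.map _) (monic_X_pow k) hk
  have hdeg : p.natDegree = k := by
    rw [← hp.natDegree_map (IsLocalRing.residue A), hk', natDegree_X_pow]
  refine ⟨⟨fun {i} hi ↦ ?_⟩, hp⟩
  rw [← IsLocalRing.residue_eq_zero_iff, ← Polynomial.coeff_map, hk', coeff_X_pow, if_neg]
  omega

theorem Polynomial.IsDistinguishedAt.prime_coe {A : Type*} [CommRing A] [IsDomain A]
    {I : Ideal A} [IsAdicComplete I A] {p : Polynomial A} (hp : p.IsDistinguishedAt I)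
    (hprime : Prime p) : Prime (p : PowerSeries A) := by
  have h0 : (p : PowerSeries A) ≠ 0 := by simpa using hprime.ne_zero
  rw [← Ideal.span_singleton_prime h0, ← Ideal.Quotient.isDomain_iff_prime]
  have : IsDomain (Polynomial A ⧸ Ideal.span {p}) := by
    rw [Ideal.Quotient.isDomain_iff_prime, Ideal.span_singleton_prime hprime.ne_zero]
    exact hprime
  exact hp.algEquivQuotient.symm.toMulEquiv.isDomain _

/-- A prime ideal of power series containing a series that is regular in the variable contains
a prime element. -/
theorem PowerSeries.exists_prime_mem_of_map_residue_ne_zero {A : Type*} [CommRing A] [IsDomain A]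
    [UniqueFactorizationMonoid A] [IsLocalRing A] [IsAdicComplete (IsLocalRing.maximalIdeal A) A]
    {P : Ideal (PowerSeries A)} (hP : P.IsPrime) {f : PowerSeries A} (hf : f ∈ P)
    (hreg : f.map (IsLocalRing.residue A) ≠ 0) : ∃ q ∈ P, Prime q := by
  obtain ⟨w, h, hw, hh, rfl⟩ := f.exists_isWeierstrassFactorization hreg
  have hwP : (w : PowerSeries A) ∈ P :=
    (hP.mem_or_mem hf).resolve_right fun H ↦ hP.ne_top (P.eq_top_of_isUnit_mem H hh)
  have hw0 : w ≠ 0 := hw.monic.ne_zero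
  obtain ⟨s, hs, hsw⟩ := UniqueFactorizationMonoid.exists_prime_factors w hw0
  let φ : Polynomial A →+* PowerSeries A := Polynomial.coeToPowerSeries.ringHom
  have hP' : (P.comap φ).IsPrime := hP.comap φ
  have hsP : s.prod ∈ P.comap φ := by
    obtain ⟨u, hu⟩ := hsw.symm
    rw [← hu]
    exact Ideal.mul_mem_right _ _ hwP
  obtain ⟨q, hqs, hqP⟩ := (hP'.multiset_prod_mem_iff_exists_mem s).1 hsP
  have hqw : q ∣ w := (Multiset.dvd_prod hqs).trans hsw.dvd
  obtain ⟨u, hu⟩ := hw.monic.isUnit_leadingCoeff_of_dvd hqw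
  have hassoc : Associated (q * Polynomial.C (↑u⁻¹ : A)) q :=
    (associated_mul_unit_left q _ (u⁻¹.isUnit.map Polynomial.C))
  have hmonic : (q * Polynomial.C (↑u⁻¹ : A)).Monic := by
    rw [Polynomial.Monic, Polynomial.leadingCoeff_mul, Polynomial.leadingCoeff_C, ← hu]
    simp
  refine ⟨_, ?_, (hmonic.isDistinguishedAt_of_dvd hw (hassoc.dvd.trans hqw)).prime_coe
    (hassoc.symm.prime (hs q hqs))⟩
  exact (P.comap φ).mul_mem_right _ hqP

namespace MvPowerSeries

theorem maximalIdeal_eq_span_range_X (σ F : Type*) [Finite σ] [Field F] :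
    IsLocalRing.maximalIdeal (MvPowerSeries σ F) = Ideal.span (Set.range X) := by
  classical
  have := Fintype.ofFinite σ
  apply le_antisymm
  · intro f hf
    have hf0 : coeff 0 f = 0 := by
      rw [IsLocalRing.mem_maximalIdeal, mem_nonunits_iff, isUnit_iff_constantCoeff] at hf
      simpa using hf
    have hc : ∀ d : σ →₀ ℕ, d ≠ 0 → ∃ i, d i ≠ 0 := fun d hd ↦ by
      simpa [Finsupp.ext_iff] using hd
    rcases isEmpty_or_nonempty σ with hσ | hσ
    · have : f = 0 := by
        ext d
        rw [Subsingleton.elim d 0, hf0, map_zero]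
      simp [this]
    choose! c hc using hc
    let g (i : σ) : MvPowerSeries σ F := fun d ↦
      if c (d + Finsupp.single i 1) = i then coeff (d + Finsupp.single i 1) f else 0
    have hg : ∀ i d, coeff d (g i) =
      if c (d + Finsupp.single i 1) = i then coeff (d + Finsupp.single i 1) f else 0 :=
      fun _ _ ↦ rfl
    have : f = ∑ i, g i * X i := by
      ext d
      have hterm : ∀ i, coeff d (g i * X i) = if d i ≠ 0 ∧ c d = i then coeff d f else 0 := by
        intro i
        rw [X, coeff_mul_monomial, hg]
        by_cases h : Finsupp.single i 1 ≤ d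
        · rw [if_pos h, tsub_add_cancel_of_le h]
          rw [Finsupp.single_le_iff, Nat.one_le_iff_ne_zero] at h
          simp [h]
        · rw [if_neg h]
          rw [Finsupp.single_le_iff, Nat.one_le_iff_ne_zero] at h
          simp [h]
      rw [map_sum, Finset.sum_congr rfl fun i _ ↦ hterm i]
      by_cases hd : d = 0
      · simp [hd, hf0]
      · rw [Finset.sum_eq_single (c d)]
        · simp [hc d hd]
        · intro b _ hb
          simp [hb.symm]
        · simp
    rw [this]
    exact Ideal.sum_mem _ fun i _ ↦ Ideal.mul_mem_left _ _ (Ideal.subset_span ⟨i, rfl⟩)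
  · rw [Ideal.span_le]
    rintro _ ⟨i, rfl⟩
    simp [isUnit_iff_constantCoeff]

/-- Positive weights, equal to `1` at the index `0`, for which the weighted degree attains its
minimum on a given set of exponents only once. -/
theorem exists_weight {n : ℕ} (S : Set (Fin n → ℕ)) (hS : S.Nonempty) :
    ∃ k : Fin n → ℕ, (∀ i, k i ≠ 0) ∧ (∀ i : Fin n, (i : ℕ) = 0 → k i = 1) ∧
      ∃ d ∈ S, ∀ e ∈ S, e ≠ d → ∑ i, d i * k i < ∑ i, e i * k i := by
  induction n with
  | zero =>
    obtain ⟨d, hd⟩ := hS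
    exact ⟨0, finZeroElim, finZeroElim, d, hd, fun e _ h ↦ (h (Subsingleton.elim _ _)).elim⟩
  | succ n ih =>
    let m := sInf ((fun d ↦ d (Fin.last n)) '' S)
    obtain ⟨d₀, hd₀, hm⟩ : ∃ d ∈ S, d (Fin.last n) = m := Nat.sInf_mem (hS.image _)
    have hmin : ∀ e ∈ S, m ≤ e (Fin.last n) := fun e he ↦ Nat.sInf_le ⟨e, he, rfl⟩
    obtain ⟨k, hk0, hk1, d, hd, hlt⟩ := ih {d | Fin.snoc (α := fun _ ↦ ℕ) d m ∈ S} ⟨Fin.init d₀, by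
      rw [Set.mem_ofPred_eq, ← hm, Fin.snoc_init_self]; exact hd₀⟩
    refine ⟨Fin.snoc (α := fun _ ↦ ℕ) k (∑ i, d i * k i + 1), ?_, ?_, _, hd, ?_⟩
    · intro i
      refine Fin.lastCases ?_ (fun i ↦ ?_) i <;> simp [hk0]
    · intro i
      refine Fin.lastCases ?_ (fun i ↦ ?_) i
      · rintro h
        obtain rfl : n = 0 := by simpa using h
        rw [Fin.snoc_last]
        simp
      · simpa using hk1 i
    · intro e he hne
      simp only [Fin.sum_univ_castSucc, Fin.snoc_castSucc, Fin.snoc_last]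
      rcases (hmin e he).eq_or_lt with h | h
      · have := hlt (Fin.init e) (by
          rw [Set.mem_ofPred_eq, h, Fin.snoc_init_self]; exact he) (by
          rintro rfl
          exact hne (by rw [h, Fin.snoc_init_self]))
        simp only [Fin.init] at this
        rw [← h]
        omega
      · have := Nat.mul_le_mul_right (∑ i, d i * k i + 1) h
        rw [Nat.succ_mul] at this
        omega

variable {F : Type*} [Field F] {n : ℕ}

/-- The family defining the shear automorphism `Xᵢ ↦ Xᵢ + c X₀ ^ kᵢ` for `i ≠ 0`, `X₀ ↦ X₀`. -/
noncomputable def shear (k : Fin (n + 1) → ℕ) (c : F) :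
    Fin (n + 1) → MvPowerSeries (Fin (n + 1)) F :=
  fun i ↦ if i = 0 then X 0 else X i + C c * X 0 ^ k i

theorem hasSubst_shear {k : Fin (n + 1) → ℕ} (hk : ∀ i, k i ≠ 0) (c : F) :
    HasSubst (shear k c) := by
  refine hasSubst_of_constantCoeff_zero fun i ↦ ?_
  unfold shear
  split_ifs <;> simp [hk]

theorem subst_shear_shear {k : Fin (n + 1) → ℕ} (hk : ∀ i, k i ≠ 0) {c c' : F} (h : c' + c = 0)
    (f : MvPowerSeries (Fin (n + 1)) F) : subst (shear k c) (subst (shear k c') f) = f := by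
  rw [subst_comp_subst_apply (hasSubst_shear hk c') (hasSubst_shear hk c)]
  have : (fun i ↦ subst (shear k c) (shear k c' i)) = X := by
    funext i
    have h0 : subst (shear k c) (X 0 : MvPowerSeries (Fin (n + 1)) F) = X 0 := by
      rw [subst_X (hasSubst_shear hk c), shear, if_pos rfl]
    by_cases hi : i = 0
    · simp only [shear, hi, if_true]
      exact h0
    · rw [shear, if_neg hi, subst_add (hasSubst_shear hk c), subst_mul (hasSubst_shear hk c),
        subst_pow (hasSubst_shear hk c), h0, subst_C, subst_X (hasSubst_shear hk c), shear,
        if_neg hi, add_assoc, ← add_mul, ← map_add, add_comm c, h]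
      simp
  rw [this, subst_self, id]

/-- The shear automorphism `Xᵢ ↦ Xᵢ + X₀ ^ kᵢ` for `i ≠ 0`, `X₀ ↦ X₀`. -/
noncomputable def shearEquiv (k : Fin (n + 1) → ℕ) (hk : ∀ i, k i ≠ 0) :
    MvPowerSeries (Fin (n + 1)) F ≃+* MvPowerSeries (Fin (n + 1)) F where
  toFun := subst (shear k 1)
  invFun := subst (shear k (-1))
  left_inv := subst_shear_shear hk (by ring)
  right_inv := subst_shear_shear hk (by ring)
  map_mul' := subst_mul (hasSubst_shear hk 1)
  map_add' := subst_add (hasSubst_shear hk 1)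

/-- The specialisation `Xᵢ ↦ 0` for `i ≠ 0`, `X₀ ↦ X`. -/
noncomputable def toPowerSeriesZero (F : Type*) [Field F] (n : ℕ) :
    MvPowerSeries (Fin (n + 1)) F →+* PowerSeries F :=
  (PowerSeries.map constantCoeff).comp (finSuccEquiv F n).toRingEquiv.toRingHom

theorem coeff_toPowerSeriesZero (f : MvPowerSeries (Fin (n + 1)) F) (N : ℕ) :
    PowerSeries.coeff N (toPowerSeriesZero F n f) = coeff (Finsupp.single 0 N) f := by
  have : Finsupp.cons N (0 : Fin n →₀ ℕ) = Finsupp.single 0 N := by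
    ext i
    refine Fin.cases ?_ (fun i ↦ ?_) i <;> simp
  simp [toPowerSeriesZero, ← coeff_zero_eq_constantCoeff_apply, coeff_coeff_finSuccEquiv, this]

theorem toPowerSeriesZero_shear {k : Fin (n + 1) → ℕ} (h0 : k 0 = 1) (i : Fin (n + 1)) :
    toPowerSeriesZero F n (shear k 1 i) = PowerSeries.X ^ k i := by
  have hX0 : toPowerSeriesZero F n (X 0) = PowerSeries.X := by
    simp [toPowerSeriesZero]
  by_cases hi : i = 0
  · simp [shear, hi, hX0, h0]
  · obtain ⟨j, rfl⟩ := Fin.exists_succ_eq.2 hi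
    rw [shear, if_neg hi, map_add, map_mul, map_pow, hX0]
    simp [toPowerSeriesZero]

theorem exists_toPowerSeriesZero_shearEquiv_ne_zero {f : MvPowerSeries (Fin (n + 1)) F}
    (hf : f ≠ 0) : ∃ (k : Fin (n + 1) → ℕ) (hk : ∀ i, k i ≠ 0),
      toPowerSeriesZero F n (shearEquiv k hk f) ≠ 0 := by
  obtain ⟨d₀, hd₀⟩ : ∃ d, coeff d f ≠ 0 := by
    contrapose! hf
    ext d
    simpa using hf d
  obtain ⟨k, hk, hk1, d, hd, hlt⟩ :=
    exists_weight {d : Fin (n + 1) → ℕ | coeff (Finsupp.equivFunOnFinite.symm d) f ≠ 0}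
      ⟨d₀, by simpa using hd₀⟩
  refine ⟨k, hk, fun h ↦ hd ?_⟩
  have key := congrArg (PowerSeries.coeff (∑ i, d i * k i)) h
  rw [coeff_toPowerSeriesZero, map_zero] at key
  change coeff _ (subst (shear k 1) f) = 0 at key
  have hmon (e : Fin (n + 1) →₀ ℕ) :
      coeff (Finsupp.single 0 (∑ i, d i * k i)) (e.prod fun s m ↦ shear (F := F) k 1 s ^ m) =
        if ∑ i, e i * k i = ∑ i, d i * k i then 1 else 0 := by
    rw [← coeff_toPowerSeriesZero, Finsupp.prod_fintype _ _ (by simp), map_prod]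
    simp_rw [map_pow, toPowerSeriesZero_shear (hk1 0 rfl), ← pow_mul, Finset.prod_pow_eq_pow_sum,
      PowerSeries.coeff_X_pow, mul_comm (k _), eq_comm]
  rw [coeff_subst (hasSubst_shear hk 1), finsum_eq_single _ (Finsupp.equivFunOnFinite.symm d)] at key
  · rw [hmon] at key
    simpa using key
  · intro e he
    rw [hmon]
    by_cases hc : coeff e f = 0
    · simp [hc]
    · rw [if_neg, smul_zero]
      refine (hlt e (by simpa using hc) ?_).ne'
      rintro rfl
      exact he (by simp)

instance isAdicComplete_maximalIdeal (σ F : Type*) [Finite σ] [Field F] :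
    IsAdicComplete (IsLocalRing.maximalIdeal (MvPowerSeries σ F)) (MvPowerSeries σ F) := by
  rw [maximalIdeal_eq_span_range_X]
  infer_instance

theorem uniqueFactorizationMonoid_fin (F : Type*) [Field F] (n : ℕ) :
    UniqueFactorizationMonoid (MvPowerSeries (Fin n) F) := by
  induction n with
  | zero =>
    exact (isEmptyEquiv (σ := Fin 0) (R := F)).symm.toMulEquiv.uniqueFactorizationMonoid
      inferInstance
  | succ n ih =>
    have := NoZeroDivisors.to_isDomain (MvPowerSeries (Fin n) F)
    have := NoZeroDivisors.to_isDomain (MvPowerSeries (Fin (n + 1)) F)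
    refine UniqueFactorizationMonoid.iff_exists_prime_mem_of_isPrime.2 fun P hP0 hP ↦ ?_
    obtain ⟨f, hfP, hf⟩ := Submodule.exists_mem_ne_zero_of_ne_bot hP0
    obtain ⟨k, hk, hkf⟩ := exists_toPowerSeriesZero_shearEquiv_ne_zero hf
    let e : MvPowerSeries (Fin (n + 1)) F ≃+* PowerSeries (MvPowerSeries (Fin n) F) :=
      (shearEquiv k hk).trans (finSuccEquiv F n).toRingEquiv
    have hQ : (P.comap e.symm).IsPrime := hP.comap _
    obtain ⟨q, hq, hqp⟩ := PowerSeries.exists_prime_mem_of_map_residue_ne_zero hQ (f := e f)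
      (by simpa using hfP) (by
        contrapose! hkf
        ext N
        have := congrArg (PowerSeries.coeff N) hkf
        rw [PowerSeries.coeff_map, map_zero, IsLocalRing.residue_eq_zero_iff,
          IsLocalRing.mem_maximalIdeal, mem_nonunits_iff, isUnit_iff_constantCoeff] at this
        rw [isUnit_iff_ne_zero, not_not] at this
        exact this)
    exact ⟨e.symm q, hq, (MulEquiv.prime_iff e.symm.toMulEquiv).2 hqp⟩

end MvPowerSeries

section Limit

variable {R : Type*} [CommRing R] {A : ℕ → Type*} [∀ n, CommRing (A n)] [∀ n, IsDomain (A n)]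
  {π : ∀ n, R →+* A n} {ρ : ∀ {i j : ℕ}, i ≤ j → A j →+* A i}

/-- Divisibility in a complete inverse limit of domains can be tested levelwise. -/
theorem dvd_of_forall_map_dvd (hπ : ∀ n, Function.Surjective (π n))
    (hρ : ∀ {i j : ℕ} (h : i ≤ j) (x : R), ρ h (π j x) = π i x)
    (hinj : ∀ x : R, (∀ n, π n x = 0) → x = 0)
    (hlim : ∀ x : ℕ → R, (∀ n, π n (x (n + 1)) = π n (x n)) → ∃ y, ∀ n, π n y = π n (x n))
    {f g : R} (hf : ∀ n, π n f ≠ 0) (h : ∀ n, π n f ∣ π n g) : f ∣ g := by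
  have h' : ∀ n, ∃ x : R, π n (f * x) = π n g := fun n ↦ by
    obtain ⟨c, hc⟩ := h n
    obtain ⟨x, rfl⟩ := hπ n c
    exact ⟨x, by rw [map_mul, hc]⟩
  choose x hx using h'
  obtain ⟨y, hy⟩ := hlim x fun n ↦ by
    apply mul_left_cancel₀ (hf n)
    rw [← map_mul, ← map_mul, hx n, ← hρ (Nat.le_succ n) (f * x (n + 1)), hx (n + 1), hρ]
  refine ⟨y, sub_eq_zero.1 (hinj _ fun n ↦ ?_)⟩
  rw [map_sub, map_mul, hy, ← map_mul, hx, sub_self]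

/-- An irreducible element of a complete inverse limit of unique factorization domains is
irreducible at some level. -/
theorem exists_irreducible_map_of_irreducible [∀ n, UniqueFactorizationMonoid (A n)]
    [∀ n, IsLocalHom (π n)] (hπ : ∀ n, Function.Surjective (π n))
    (hρ : ∀ {i j : ℕ} (h : i ≤ j) (x : R), ρ h (π j x) = π i x)
    (hinj : ∀ x : R, (∀ n, π n x = 0) → x = 0)
    (hlim : ∀ x : ℕ → R, (∀ n, π n (x (n + 1)) = π n (x n)) → ∃ y, ∀ n, π n y = π n (x n))
    {f : R} (hf : ∀ n, π n f ≠ 0) (hirr : Irreducible f) : ∃ n, Irreducible (π n f) := by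
  by_contra! hred
  let D (n : ℕ) : Set (Associates (A n)) :=
    {x | ∃ a b : R, ¬ IsUnit a ∧ ¬ IsUnit b ∧ π n (a * b) = π n f ∧ x = Associates.mk (π n a)}
  have hfin (n : ℕ) : Finite (D n) := by
    have h0 : Associates.mk (π n f) ≠ 0 := by simpa using hf n
    have := UniqueFactorizationMonoid.fintypeSubtypeDvd _ h0
    have hs : (D n) ⊆ {x | x ∣ Associates.mk (π n f)} := by
      rintro _ ⟨a, b, -, -, hab, rfl⟩
      exact Associates.mk_dvd_mk.2 ⟨π n b, by rw [← hab, map_mul]⟩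
    have hd : {x | x ∣ Associates.mk (π n f)}.Finite :=
      Set.finite_coe_iff.1 (Finite.of_fintype {x // x ∣ Associates.mk (π n f)})
    exact hd.subset hs
  have hne (n : ℕ) : Nonempty (D n) := by
    have hu : ¬ IsUnit (π n f) := fun h ↦ hirr.not_isUnit (isUnit_of_map_unit (π n) f h)
    have := hred n
    simp only [irreducible_iff, hu, not_false_eq_true, true_and, not_forall, not_or] at this
    obtain ⟨a, b, hab, ha, hb⟩ := this
    obtain ⟨a, rfl⟩ := hπ n a
    obtain ⟨b, rfl⟩ := hπ n b
    exact ⟨_, a, b, fun h ↦ ha (h.map _), fun h ↦ hb (h.map _), by rw [hab, map_mul], rfl⟩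
  let p {i j : ℕ} (h : i ≤ j) : Associates (A j) → Associates (A i) :=
    Quotient.map (ρ h) fun _ _ hab ↦ Associated.map (ρ h) hab
  have hp {i j : ℕ} (h : i ≤ j) (x : R) :
      p h (Associates.mk (π j x)) = Associates.mk (π i x) := by
    rw [← hρ h]
    rfl
  have hpD {i j : ℕ} (h : i ≤ j) (x : Associates (A j)) (hx : x ∈ D j) : p h x ∈ D i := by
    obtain ⟨a, b, ha, hb, hab, rfl⟩ := hx
    exact ⟨a, b, ha, hb, by rw [← hρ h, hab, hρ], hp h a⟩
  obtain ⟨c, hc⟩ := exists_seq_forall_proj_of_forall_finite (α := fun n ↦ D n)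
    (fun h x ↦ ⟨p h x.1, hpD h x.1 x.2⟩)
    (by
      rintro i ⟨_, a, b, ha, hb, hab, rfl⟩
      exact Subtype.ext (hp _ a))
    (by
      rintro i j k hij hjk ⟨_, a, b, ha, hb, hab, rfl⟩
      simp only [hp])
    (fun i a ↦ Set.toFinite _)
  have hstep (n : ℕ) (x : R) (hx : Associates.mk (π n x) = c n) :
      ∃ x' : R, Associates.mk (π (n + 1) x') = c (n + 1) ∧ π n x' = π n x := by
    obtain ⟨a, -, -, -, -, ha⟩ := (c (n + 1)).2
    have h1 : Associates.mk (π n a) = Associates.mk (π n x) := by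
      rw [hx, ← hc (Nat.le_succ n), ← hp (Nat.le_succ n), ← ha]
    obtain ⟨u, hu⟩ := Associates.mk_eq_mk_iff_associated.1 h1
    obtain ⟨v, hv⟩ := hπ n u
    have hvu : IsUnit v := isUnit_of_map_unit (π n) v (hv ▸ u.isUnit)
    refine ⟨a * v, ?_, by rw [map_mul, hv, hu]⟩
    rw [ha, Associates.mk_eq_mk_iff_associated, map_mul]
    exact associated_mul_unit_left _ _ (hvu.map _)
  let x (n : ℕ) : {x : R // Associates.mk (π n x) = c n} :=
    Nat.rec ⟨(c 0).2.choose, (c 0).2.choose_spec.choose_spec.2.2.2.symm⟩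
      (fun n x ↦ ⟨(hstep n x.1 x.2).choose, (hstep n x.1 x.2).choose_spec.1⟩) n
  obtain ⟨y, hy⟩ := hlim (fun n ↦ (x n).1) fun n ↦ (hstep n (x n).1 (x n).2).choose_spec.2
  have hyc (n : ℕ) : Associates.mk (π n y) = c n := by rw [hy, (x n).2]
  have hyf (n : ℕ) : ∃ a b : R, ¬ IsUnit a ∧ ¬ IsUnit b ∧ π n (a * b) = π n f ∧
      Associated (π n y) (π n a) := by
    obtain ⟨a, b, ha, hb, hab, h⟩ := (c n).2
    exact ⟨a, b, ha, hb, hab, Associates.mk_eq_mk_iff_associated.1 (by rw [hyc, h])⟩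
  have hydvd (n : ℕ) : π n y ∣ π n f := by
    obtain ⟨a, b, -, -, hab, h⟩ := hyf n
    exact h.dvd.trans ⟨π n b, by rw [← hab, map_mul]⟩
  obtain ⟨z, hz⟩ := dvd_of_forall_map_dvd hπ hρ hinj hlim
    (fun n h ↦ hf n (zero_dvd_iff.1 (h ▸ hydvd n))) hydvd
  obtain ⟨a, b, ha, hb, hab, u, hu⟩ := hyf 0
  rcases hirr.isUnit_or_isUnit hz with h | h
  · exact ha (isUnit_of_map_unit (π 0) a (hu ▸ (h.map (π 0)).mul u.isUnit))
  · have hz' := congrArg (π 0) hz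
    rw [← hab, map_mul, map_mul, ← hu, mul_assoc] at hz'
    have hy0 : π 0 y ≠ 0 := fun h ↦ hf 0 (zero_dvd_iff.1 (h ▸ hydvd 0))
    have := mul_left_cancel₀ hy0 hz'
    exact hb (isUnit_of_map_unit (π 0) b (isUnit_of_mul_isUnit_right (this ▸ h.map (π 0))))

/-- An irreducible element of a complete inverse limit of unique factorization domains is prime. -/
theorem prime_of_irreducible_of_limit [∀ n, UniqueFactorizationMonoid (A n)]
    [∀ n, IsLocalHom (π n)] (hπ : ∀ n, Function.Surjective (π n))
    (hρ : ∀ {i j : ℕ} (h : i ≤ j) (x : R), ρ h (π j x) = π i x)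
    (hinj : ∀ x : R, (∀ n, π n x = 0) → x = 0)
    (hlim : ∀ x : ℕ → R, (∀ n, π n (x (n + 1)) = π n (x n)) → ∃ y, ∀ n, π n y = π n (x n))
    {f : R} (hf : π 0 f ≠ 0) (hirr : Irreducible f) : Prime f := by
  have hf' (n : ℕ) : π n f ≠ 0 := fun h ↦ hf (by rw [← hρ (Nat.zero_le n), h, map_zero])
  obtain ⟨N, hN⟩ := exists_irreducible_map_of_irreducible hπ hρ hinj hlim hf' hirr
  have hprime (n : ℕ) (hn : N ≤ n) : Prime (π n f) := by
    rw [← UniqueFactorizationMonoid.irreducible_iff_prime]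
    refine ⟨fun h ↦ hirr.not_isUnit (isUnit_of_map_unit (π n) f h), fun a b hab ↦ ?_⟩
    obtain ⟨a, rfl⟩ := hπ n a
    obtain ⟨b, rfl⟩ := hπ n b
    rw [← map_mul] at hab
    have := hN.isUnit_or_isUnit (a := π N a) (b := π N b) (by
      rw [← map_mul, ← hρ hn, hab, hρ])
    exact this.imp (fun h ↦ (isUnit_of_map_unit _ _ h).map _)
      (fun h ↦ (isUnit_of_map_unit _ _ h).map _)
  have hdown {i j : ℕ} (hij : i ≤ j) (g : R) (h : π j f ∣ π j g) : π i f ∣ π i g := by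
    rw [← hρ hij, ← hρ hij]
    exact map_dvd _ h
  have hdvd (g : R) (h : ∀ n, π n f ∣ π n g) : f ∣ g :=
    dvd_of_forall_map_dvd hπ hρ hinj hlim hf' h
  refine ⟨hirr.ne_zero, hirr.not_isUnit, fun g h hgh ↦ ?_⟩
  by_contra! hcon
  obtain ⟨i, hi⟩ := not_forall.1 (mt (hdvd g) hcon.1)
  obtain ⟨j, hj⟩ := not_forall.1 (mt (hdvd h) hcon.2)
  let n := max N (max i j)
  have := (hprime n (le_max_left _ _)).dvd_or_dvd (a := π n g) (b := π n h) (by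
    rw [← map_mul]
    exact map_dvd _ hgh)
  rcases this with h | h
  · exact hi (hdown ((le_max_left i j).trans (le_max_right _ _)) _ h)
  · exact hj (hdown ((le_max_right i j).trans (le_max_right _ _)) _ h)

end Limit

namespace MvPowerSeries

variable {F : Type*} [Field F]

/-- The truncation of a power series in variables indexed by `ℕ` to the first `n` variables. -/
noncomputable def truncVars (F : Type*) [Field F] (n : ℕ) :
    MvPowerSeries ℕ F →+* MvPowerSeries (Fin n) F :=
  (killCompl Fin.valEmbedding).toRingHom

theorem coeff_truncVars {n : ℕ} (f : MvPowerSeries ℕ F) (d : Fin n →₀ ℕ) :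
    coeff d (truncVars F n f) = coeff (d.embDomain Fin.valEmbedding) f :=
  coeff_killCompl f d

theorem truncVars_surjective (n : ℕ) : Function.Surjective (truncVars F n) :=
  fun p ↦ ⟨rename Fin.valEmbedding p, killCompl_rename_app p⟩

instance isLocalHom_truncVars (n : ℕ) : IsLocalHom (truncVars F n) where
  map_nonunit f hf := by
    rw [isUnit_iff_constantCoeff, ← coeff_zero_eq_constantCoeff_apply] at hf ⊢
    rwa [coeff_truncVars, Finsupp.embDomain_zero] at hf

theorem truncVars_eq_iff {n : ℕ} {f g : MvPowerSeries ℕ F} : truncVars F n f = truncVars F n g ↔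
    ∀ d : ℕ →₀ ℕ, (∀ i ∈ d.support, i < n) → coeff d f = coeff d g := by
  refine ⟨fun h d hd ↦ ?_, fun h ↦ ?_⟩
  · have hd' : (d.support : Set ℕ) ⊆ Set.range (Fin.valEmbedding (n := n)) :=
      fun i hi ↦ ⟨⟨i, hd i hi⟩, rfl⟩
    have := congrArg (coeff (d.comapDomain _ Fin.valEmbedding.injective.injOn)) h
    rwa [coeff_truncVars, coeff_truncVars, Finsupp.embDomain_comapDomain hd'] at this
  · ext d
    rw [coeff_truncVars, coeff_truncVars]
    refine h _ fun i hi ↦ ?_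
    rw [Finsupp.support_embDomain, Finset.mem_map] at hi
    obtain ⟨j, -, rfl⟩ := hi
    exact j.2

theorem exists_forall_support_lt (d : ℕ →₀ ℕ) : ∃ n, ∀ i ∈ d.support, i < n :=
  ⟨d.support.sup id + 1, fun _ hi ↦ Nat.lt_succ_of_le (Finset.le_sup (f := id) hi)⟩

theorem eq_zero_of_forall_truncVars_eq_zero {f : MvPowerSeries ℕ F} (N : ℕ)
    (h : ∀ n, truncVars F (N + n) f = 0) : f = 0 := by
  ext d
  obtain ⟨n, hn⟩ := exists_forall_support_lt d
  exact truncVars_eq_iff.1 ((h n).trans (map_zero _).symm) d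
    fun i hi ↦ (hn i hi).trans_le (Nat.le_add_left _ _)

theorem exists_truncVars_eq {N : ℕ} (x : ℕ → MvPowerSeries ℕ F)
    (hx : ∀ n, truncVars F (N + n) (x (n + 1)) = truncVars F (N + n) (x n)) :
    ∃ y, ∀ n, truncVars F (N + n) y = truncVars F (N + n) (x n) := by
  have hstable {d : ℕ →₀ ℕ} {m n : ℕ} (hmn : m ≤ n) (hd : ∀ i ∈ d.support, i < N + m) :
      coeff d (x n) = coeff d (x m) := by
    induction n, hmn using Nat.le_induction with
    | base => rfl
    | succ n hmn ih =>
      rw [← ih]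
      exact truncVars_eq_iff.1 (hx n) d fun i hi ↦ (hd i hi).trans_le (by omega)
  choose b hb using exists_forall_support_lt
  refine ⟨fun d ↦ coeff d (x (b d)), fun n ↦ truncVars_eq_iff.2 fun d hd ↦ ?_⟩
  change coeff d (x (b d)) = _
  rcases le_total (b d) n with h | h
  · exact (hstable h fun i hi ↦ (hb d i hi).trans_le (by omega)).symm
  · exact hstable h hd

theorem prime_of_irreducible {f : MvPowerSeries ℕ F} (hf : Irreducible f) : Prime f := by
  obtain ⟨N, hN⟩ : ∃ N, truncVars F (0 + N) f ≠ 0 := by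
    by_contra! h
    exact hf.ne_zero (eq_zero_of_forall_truncVars_eq_zero 0 h)
  rw [zero_add] at hN
  have (n : ℕ) := NoZeroDivisors.to_isDomain (MvPowerSeries (Fin (N + n)) F)
  have (n : ℕ) := uniqueFactorizationMonoid_fin F (N + n)
  refine prime_of_irreducible_of_limit (π := fun n ↦ truncVars F (N + n))
    (ρ := fun {i j} h ↦
      (killCompl (R := F) (Fin.castLEEmb (Nat.add_le_add_left h N))).toRingHom)
    (fun n ↦ truncVars_surjective _) (fun h x ↦ ?_)
    (fun x ↦ eq_zero_of_forall_truncVars_eq_zero N) exists_truncVars_eq hN hf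
  ext d
  rw [coeff_truncVars]
  refine (coeff_killCompl _ d).trans ?_
  rw [coeff_truncVars, ← Finsupp.embDomain_trans_apply]
  rfl

instance wfDvdMonoid (σ F : Type*) [Field F] : WfDvdMonoid (MvPowerSeries σ F) where
  wf := by
    refine Subrelation.wf (r := InvImage (· < ·) order) (fun {f g} h ↦ ?_)
      (InvImage.wf _ wellFounded_lt)
    obtain ⟨hf, c, hc, rfl⟩ := h
    have hc' : c.order ≠ 0 := by
      rw [order_ne_zero_iff_constCoeff_eq_zero]
      simpa [isUnit_iff_constantCoeff] using hc
    change f.order < (f * c).order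
    rw [order_mul, add_comm]
    have hf' : f.order ≠ ⊤ := by rwa [ne_eq, order_eq_top_iff]
    exact ENat.lt_add_left hf' (pos_iff_ne_zero.2 hc')

theorem uniqueFactorizationMonoid_nat (F : Type*) [Field F] :
    UniqueFactorizationMonoid (MvPowerSeries ℕ F) :=
  have := NoZeroDivisors.to_isDomain (MvPowerSeries ℕ F)
  { wfDvdMonoid ℕ F with
    irreducible_iff_prime := ⟨prime_of_irreducible, Prime.irreducible⟩ }

theorem uniqueFactorizationMonoid_of_denumerable (σ F : Type*) [Denumerable σ] [Field F] :
    UniqueFactorizationMonoid (MvPowerSeries σ F) :=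
  (renameEquiv F (Denumerable.eqv σ).symm).toMulEquiv.uniqueFactorizationMonoid
    (uniqueFactorizationMonoid_nat F)

end MvPowerSeries

/-- Prime factorization as an equivalence between finitely supported exponents and `ℕ+`. -/
noncomputable def PNat.primeExponentsEquiv : (Nat.Primes →₀ ℕ) ≃ ℕ+ :=
  Multiset.toFinsupp.symm.toEquiv.trans PNat.factorMultisetEquiv.symm

theorem PNat.primeExponentsEquiv_add (d e : Nat.Primes →₀ ℕ) :
    primeExponentsEquiv (d + e) = primeExponentsEquiv d * primeExponentsEquiv e := by
  change PrimeMultiset.prod (Multiset.toFinsupp.symm (d + e)) = _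
  rw [map_add]
  exact PrimeMultiset.prod_add _ _

namespace ArithmeticFunction

/-- Arithmetic functions are formal power series in variables indexed by the primes. -/
noncomputable def equivMvPowerSeries (R : Type*) [CommRing R] :
    ArithmeticFunction R ≃+* MvPowerSeries Nat.Primes R where
  toFun f d := f (PNat.primeExponentsEquiv d)
  invFun g := ⟨fun n ↦ if h : 0 < n then g (PNat.primeExponentsEquiv.symm (n.toPNat h)) else 0, by simp⟩
  left_inv f := by
    ext n
    rcases n.eq_zero_or_pos with rfl | h
    · simp
    · refine (dif_pos h).trans ?_
      exact congrArg (fun m : ℕ+ ↦ f m) (Equiv.apply_symm_apply _ (n.toPNat h))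
  right_inv g := by
    funext d
    refine (dif_pos (PNat.pos _)).trans ?_
    exact congrArg g (Equiv.symm_apply_apply _ d)
  map_add' f g := rfl
  map_mul' f g := by
    classical
    ext d
    refine Eq.trans ?_ (MvPowerSeries.coeff_mul _ _ _).symm
    refine (mul_apply (f := f) (g := g) (n := PNat.primeExponentsEquiv d)).trans ?_
    symm
    refine Finset.sum_bij (fun x _ ↦
      ((PNat.primeExponentsEquiv x.1 : ℕ), (PNat.primeExponentsEquiv x.2 : ℕ))) ?_ ?_ ?_ ?_
    · intro x hx
      rw [Finset.HasAntidiagonal.mem_antidiagonal] at hx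
      rw [Nat.mem_divisorsAntidiagonal, ← hx, PNat.primeExponentsEquiv_add, PNat.mul_coe]
      exact ⟨rfl, mul_ne_zero (PNat.ne_zero _) (PNat.ne_zero _)⟩
    · rintro ⟨a, b⟩ _ ⟨c, d⟩ _ h
      simpa using h
    · rintro ⟨a, b⟩ hab
      rw [Nat.mem_divisorsAntidiagonal] at hab
      lift a to ℕ+ using Nat.pos_of_ne_zero fun h ↦ hab.2 (by rw [← hab.1, h, zero_mul])
      lift b to ℕ+ using Nat.pos_of_ne_zero fun h ↦ hab.2 (by rw [← hab.1, h, mul_zero])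
      refine ⟨(PNat.primeExponentsEquiv.symm a, PNat.primeExponentsEquiv.symm b),
        ?_, by simp⟩
      rw [Finset.HasAntidiagonal.mem_antidiagonal, ← PNat.primeExponentsEquiv.injective.eq_iff,
        PNat.primeExponentsEquiv_add]
      apply PNat.eq
      simpa using hab.1
    · intro x _
      rfl

theorem uniqueFactorizationMonoid (F : Type*) [Field F] :
    UniqueFactorizationMonoid (ArithmeticFunction F) := by
  obtain ⟨_⟩ := nonempty_denumerable Nat.Primes
  exact (equivMvPowerSeries F).symm.toMulEquiv.uniqueFactorizationMonoid
    (MvPowerSeries.uniqueFactorizationMonoid_of_denumerable Nat.Primes F)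

end ArithmeticFunction

/-- The ring of arithmetic functions over a field is a unique factorization domain:
every nonzero element is a unit times a finite product of irreducibles, and this
representation is unique up to order and replacement of factors by associates. -/
theorem stmt_10 (F : Type*) [Field F] :
    (∀ α : ArithmeticFunction F, α ≠ 0 →
      ∃ (u : (ArithmeticFunction F)ˣ) (s : Multiset (ArithmeticFunction F)),
        (∀ π ∈ s, Irreducible π) ∧ (u : ArithmeticFunction F) * s.prod = α) ∧
    (∀ (u v : (ArithmeticFunction F)ˣ) (s t : Multiset (ArithmeticFunction F)),
      (∀ π ∈ s, Irreducible π) → (∀ π ∈ t, Irreducible π) →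
      (u : ArithmeticFunction F) * s.prod = (v : ArithmeticFunction F) * t.prod →
      Multiset.Rel Associated s t) := by
  have := ArithmeticFunction.uniqueFactorizationMonoid F
  refine ⟨fun α hα ↦ ?_, fun u v s t hs ht h ↦ ?_⟩
  · obtain ⟨s, hs, u, hu⟩ := WfDvdMonoid.exists_factors α hα
    exact ⟨u, s, hs, by rw [mul_comm, hu]⟩
  · refine UniqueFactorizationMonoid.factors_unique hs ht ?_
    exact (associated_unit_mul_left s.prod u u.isUnit).symm.trans
      (h ▸ associated_unit_mul_left t.prod v v.isUnit)
end
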